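/- Let S be a bounded distributive lattice, regarded as a commutative semiring with addition a + b = a ⊔ b, multiplication a · b = a ⊓ b, zero ⊥, and one ⊤. The following are equivalent: (1) all finitely generated S-semimodules are e-injective; (2) all cyclic S-semimodules are e-injective; (3) S is a finite Boolean algebra, i.e., S is finite and every element of S has a complement. -/

import Mathlib

universe u v w w'

/-- A subsemimodule `A ≤ B` is subtractive if `m ∈ A` and `m + m' ∈ A` imply `m' ∈ A`. -/
def IsSubtractive {S : Type u} [Semiring S] {B : Type v} [AddCommMonoid B] [Module S B]
    (A : Submodule S B) : Prop :=
  ∀ m m' : B, m ∈ A → m + m' ∈ A → m' ∈ A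

/-- A left `S`-semimodule `M` is e-injective if for every semimodule `B` and every
subtractive subsemimodule `A ≤ B`, every linear map `A → M` extends to `B`, and any two
linear maps `B → M` agreeing on `A` differ by maps vanishing on `A`. -/
def EInjective (S : Type u) [Semiring S] (M : Type v) [AddCommMonoid M] [Module S M] : Prop :=
  ∀ (B : Type w) [AddCommMonoid B] [Module S B] (A : Submodule S B), IsSubtractive A →
    ((∀ φ : A →ₗ[S] M, ∃ ψ : B →ₗ[S] M, ∀ a : A, ψ (a : B) = φ a) ∧
     (∀ ψ₁ ψ₂ : B →ₗ[S] M, (∀ a ∈ A, ψ₁ a = ψ₂ a) →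
       ∃ χ₁ χ₂ : B →ₗ[S] M, (∀ a ∈ A, χ₁ a = 0) ∧ (∀ a ∈ A, χ₂ a = 0) ∧
         ψ₁ + χ₁ = ψ₂ + χ₂))

/-- A left `S`-semimodule `M` is injective if every linear map into `M` extends along
every injective linear map. -/
def SInjective (S : Type u) [Semiring S] (M : Type v) [AddCommMonoid M] [Module S M] : Prop :=
  ∀ (A : Type w) (B : Type w') [AddCommMonoid A] [Module S A] [AddCommMonoid B] [Module S B]
    (μ : A →ₗ[S] B), Function.Injective μ →
    ∀ φ : A →ₗ[S] M, ∃ ψ : B →ₗ[S] M, ∀ a : A, ψ (μ a) = φ a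


/-! ### Transfer of e-injectivity tests to small modules -/

theorem EInjAux.ext_small {S : Type u} [Semiring S] {M : Type v} [AddCommMonoid M] [Module S M]
    (h : EInjective.{u, v, w} S M) {B : Type w'} [AddCommMonoid B] [Module S B] [Small.{w} B]
    (A : Submodule S B) (hA : IsSubtractive A) (φ : A →ₗ[S] M) :
    ∃ ψ : B →ₗ[S] M, ∀ a : A, ψ (a : B) = φ a := by
  let e : Shrink.{w} B ≃ₗ[S] B := Shrink.linearEquiv S B
  let A' : Submodule S (Shrink.{w} B) := A.comap e.toLinearMap
  have hA' : IsSubtractive A' := by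
    intro m m' hm hmm
    refine hA (e m) (e m') hm ?_
    have : e (m + m') ∈ A := hmm
    simpa using this
  let r : A' →ₗ[S] A := (e.toLinearMap.comp A'.subtype).codRestrict A (fun x => x.2)
  obtain ⟨ψ, hψ⟩ := (h (Shrink.{w} B) A' hA').1 (φ.comp r)
  refine ⟨ψ.comp e.symm.toLinearMap, fun a => ?_⟩
  have ha : e.symm (a : B) ∈ A' := by
    change e (e.symm (a : B)) ∈ A
    simp
  have := hψ ⟨e.symm (a : B), ha⟩
  simp only [LinearMap.comp_apply] at this
  simp only [LinearMap.comp_apply, LinearEquiv.coe_coe]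
  rw [this]
  congr 1
  apply Subtype.ext
  change e (e.symm (a : B)) = a
  simp

theorem EInjAux.diff_small {S : Type u} [Semiring S] {M : Type v} [AddCommMonoid M] [Module S M]
    (h : EInjective.{u, v, w} S M) {B : Type w'} [AddCommMonoid B] [Module S B] [Small.{w} B]
    (A : Submodule S B) (hA : IsSubtractive A) (ψ₁ ψ₂ : B →ₗ[S] M)
    (hψ : ∀ a ∈ A, ψ₁ a = ψ₂ a) :
    ∃ χ₁ χ₂ : B →ₗ[S] M, (∀ a ∈ A, χ₁ a = 0) ∧ (∀ a ∈ A, χ₂ a = 0) ∧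
         ψ₁ + χ₁ = ψ₂ + χ₂ := by
  let e : Shrink.{w} B ≃ₗ[S] B := Shrink.linearEquiv S B
  let A' : Submodule S (Shrink.{w} B) := A.comap e.toLinearMap
  have hA' : IsSubtractive A' := by
    intro m m' hm hmm
    refine hA (e m) (e m') hm ?_
    have : e (m + m') ∈ A := hmm
    simpa using this
  obtain ⟨χ₁, χ₂, h1, h2, h3⟩ := (h (Shrink.{w} B) A' hA').2 (ψ₁.comp e.toLinearMap)
    (ψ₂.comp e.toLinearMap) (fun a ha => hψ (e a) ha)
  have key : ∀ a ∈ A, e.symm a ∈ A' := by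
    intro a ha
    change e (e.symm a) ∈ A
    simpa using ha
  refine ⟨χ₁.comp e.symm.toLinearMap, χ₂.comp e.symm.toLinearMap,
    fun a ha => h1 _ (key a ha), fun a ha => h2 _ (key a ha), ?_⟩
  ext b
  have := LinearMap.congr_fun h3 (e.symm b)
  simpa using this

/-! ### Set representations of a lattice semiring and their quotients -/

/-- A representation of a semiring by sets: addition is union, multiplication intersection. -/
structure EInjAux.Rep (S : Type u) [Semiring S] (X : Type) where
  toFun : S → Set X
  map_add : ∀ s t, toFun (s + t) = toFun s ∪ toFun t
  map_mul : ∀ s t, toFun (s * t) = toFun s ∩ toFun t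
  map_one : toFun 1 = Set.univ
  map_zero : toFun 0 = ∅

namespace EInjAux

variable {S : Type u} [Semiring S] {X : Type}

theorem setEq_top {U V : Set X} : U =ᶠ[(⊤ : Filter X)] V ↔ U = V := by
  rw [Filter.eventuallyEq_set, Filter.eventually_top, Set.ext_iff]

/-- The congruence given by equality of representing sets modulo a filter. -/
def Rep.con (f : Rep S X) (l : Filter X) : RingCon S where
  r s t := f.toFun s =ᶠ[l] f.toFun t
  iseqv := ⟨fun _ => Filter.EventuallyEq.refl _ _, fun h => h.symm, fun h h' => h.trans h'⟩
  mul' := by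
    intro a b c d h h'
    rw [f.map_mul, f.map_mul]
    exact h.inter h'
  add' := by
    intro a b c d h h'
    rw [f.map_add, f.map_add]
    exact h.union h'

/-- The quotient of `S` by the congruence. -/
def Rep.Q (f : Rep S X) (l : Filter X) : Type u := (f.con l).Quotient

instance (f : Rep S X) (l : Filter X) : AddCommMonoid (f.Q l) :=
  inferInstanceAs (AddCommMonoid (f.con l).Quotient)

instance (f : Rep S X) (l : Filter X) : Module S (f.Q l) :=
  Module.compHom (f.con l).Quotient (f.con l).mk'

/-- The quotient map. -/
def Rep.qmk (f : Rep S X) (l : Filter X) : S →ₗ[S] f.Q l where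
  toFun s := (f.con l).mk' s
  map_add' s t := (f.con l).mk'.map_add s t
  map_smul' s t := (f.con l).mk'.map_mul s t

theorem Rep.qmk_surj (f : Rep S X) (l : Filter X) : Function.Surjective (f.qmk l) :=
  fun x => (f.con l).mk'_surjective x

theorem Rep.qmk_eq (f : Rep S X) (l : Filter X) {s t : S} :
    f.qmk l s = f.qmk l t ↔ f.toFun s =ᶠ[l] f.toFun t :=
  (f.con l).eq

theorem Rep.qmk_top (f : Rep S X) {s t : S} :
    f.qmk ⊤ s = f.qmk ⊤ t ↔ f.toFun s = f.toFun t := by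
  rw [f.qmk_eq, setEq_top]

theorem Rep.cyclic (f : Rep S X) (l : Filter X) :
    ∃ m : f.Q l, Submodule.span S {m} = ⊤ := by
  refine ⟨f.qmk l 1, ?_⟩
  rw [eq_top_iff]
  intro x _
  obtain ⟨s, rfl⟩ := f.qmk_surj l x
  rw [Submodule.mem_span_singleton]
  refine ⟨s, ?_⟩
  rw [← map_smul, smul_eq_mul, mul_one]

/-- The set represented by an element of the quotient by the kernel. -/
noncomputable def Rep.val (f : Rep S X) (x : f.Q ⊤) : Set X :=
  f.toFun (f.qmk_surj ⊤ x).choose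

theorem Rep.val_mk (f : Rep S X) (s : S) : f.val (f.qmk ⊤ s) = f.toFun s :=
  f.qmk_top.1 (f.qmk_surj ⊤ (f.qmk ⊤ s)).choose_spec

theorem Rep.val_inj (f : Rep S X) : Function.Injective f.val := by
  intro x y h
  obtain ⟨s, rfl⟩ := f.qmk_surj ⊤ x
  obtain ⟨t, rfl⟩ := f.qmk_surj ⊤ y
  rw [f.val_mk, f.val_mk] at h
  exact f.qmk_top.2 h

instance (f : Rep S X) : Small.{w} (f.Q ⊤) :=
  small_of_injective f.val_inj

theorem Rep.val_add (f : Rep S X) (x y : f.Q ⊤) : f.val (x + y) = f.val x ∪ f.val y := by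
  obtain ⟨s, rfl⟩ := f.qmk_surj ⊤ x
  obtain ⟨t, rfl⟩ := f.qmk_surj ⊤ y
  rw [← _root_.map_add, f.val_mk, f.val_mk, f.val_mk, f.map_add]

theorem Rep.val_smul (f : Rep S X) (s : S) (y : f.Q ⊤) :
    f.val (s • y) = f.toFun s ∩ f.val y := by
  obtain ⟨t, rfl⟩ := f.qmk_surj ⊤ y
  rw [← map_smul, f.val_mk, f.val_mk, smul_eq_mul, f.map_mul]

theorem Rep.val_zero (f : Rep S X) : f.val 0 = ∅ := by
  rw [← _root_.map_zero (f.qmk ⊤), f.val_mk, f.map_zero]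

/-- The submodule of elements whose set lies in a set-ideal. -/
def Rep.sub (f : Rep S X) (I : Set X → Prop) (h0 : I ∅) (hu : ∀ U V, I U → I V → I (U ∪ V))
    (hd : ∀ U V, U ⊆ V → I V → I U) : Submodule S (f.Q ⊤) where
  carrier := {x | I (f.val x)}
  add_mem' := by
    intro a b ha hb
    change I (f.val (a + b))
    rw [f.val_add]
    exact hu _ _ ha hb
  zero_mem' := by
    change I (f.val 0)
    rw [f.val_zero]
    exact h0
  smul_mem' := by
    intro c x hx
    change I (f.val (c • x))
    rw [f.val_smul]
    exact hd _ _ Set.inter_subset_right hx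

theorem Rep.sub_subtractive (f : Rep S X) (I : Set X → Prop) (h0 : I ∅)
    (hu : ∀ U V, I U → I V → I (U ∪ V))
    (hd : ∀ U V, U ⊆ V → I V → I U) : IsSubtractive (f.sub I h0 hu hd) := by
  intro m m' _ hmm
  change I (f.val m')
  have : I (f.val (m + m')) := hmm
  rw [f.val_add] at this
  exact hd _ _ Set.subset_union_right this

/-- Extension lemma. -/
theorem Rep.extend (f : Rep S X) (l : Filter X) (hM : EInjective.{u, u, w} S (f.Q l))
    (I : Set X → Prop) (h0 : I ∅)
    (hu : ∀ U V, I U → I V → I (U ∪ V)) (hd : ∀ U V, U ⊆ V → I V → I U)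
    (R : Set X → Set X → Prop) (hex : ∀ U, I U → ∃ s, R U (f.toFun s))
    (huniq : ∀ U V V', R U V → R U V' → V =ᶠ[l] V')
    (hRu : ∀ U V U' V', R U V → R U' V' → R (U ∪ U') (V ∪ V'))
    (hRs : ∀ s U V, R U V → R (f.toFun s ∩ U) (f.toFun s ∩ V)) :
    ∃ s, ∀ t V, I (f.toFun t) → R (f.toFun t) V → (f.toFun t ∩ f.toFun s : Set X) =ᶠ[l] V := by
  choose g hg using hex
  let φ : f.sub I h0 hu hd →ₗ[S] f.Q l :=
    { toFun := fun x => f.qmk l (g (f.val x.1) x.2)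
      map_add' := by
        intro x y
        rw [← _root_.map_add, f.qmk_eq]
        refine huniq (f.val (x + y).1) _ _ (hg _ _) ?_
        rw [f.map_add, Submodule.coe_add, f.val_add]
        exact hRu _ _ _ _ (hg _ _) (hg _ _)
      map_smul' := by
        intro c x
        rw [RingHom.id_apply, ← map_smul, f.qmk_eq]
        refine huniq (f.val (c • x).1) _ _ (hg _ _) ?_
        rw [smul_eq_mul, f.map_mul, Submodule.coe_smul, f.val_smul]
        exact hRs _ _ _ (hg _ _) }
  obtain ⟨ψ, hψ⟩ := ext_small hM (f.sub I h0 hu hd) (f.sub_subtractive I h0 hu hd) φ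
  obtain ⟨s, hs⟩ := f.qmk_surj l (ψ (f.qmk ⊤ 1))
  refine ⟨s, fun t V ht hV => ?_⟩
  have hmem : f.qmk ⊤ t ∈ f.sub I h0 hu hd := by
    change I (f.val _)
    rwa [f.val_mk]
  have h1 := hψ ⟨f.qmk ⊤ t, hmem⟩
  have h2 : ψ (f.qmk ⊤ t) = f.qmk l (t * s) := by
    have : f.qmk ⊤ t = t • f.qmk ⊤ 1 := by
      rw [← map_smul, smul_eq_mul, mul_one]
    rw [this, map_smul, ← hs, ← map_smul, smul_eq_mul]
  have h3 : f.qmk l (t * s) = f.qmk l (g (f.val (f.qmk ⊤ t)) hmem) := h2.symm.trans h1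
  rw [f.qmk_eq, f.map_mul] at h3
  refine h3.trans (huniq (f.toFun t) _ _ ?_ hV)
  have h4 := hg _ hmem
  have h5 : ∀ (U U' W : Set X), U = U' → R U W → R U' W := by
    rintro U _ W rfl h
    exact h
  exact h5 _ _ _ (f.val_mk t) h4

/-- Complement lemma. -/
theorem Rep.compl (f : Rep S X) (hM : EInjective.{u, u, w} S (f.Q ⊤)) (a : S) :
    ∃ n, f.toFun n = (f.toFun a)ᶜ := by
  have hd : ∀ U V : Set X, U ⊆ V → V ⊆ f.toFun a → U ⊆ f.toFun a :=
    fun _ _ h h' => h.trans h'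
  let A := f.sub (fun U => U ⊆ f.toFun a) (Set.empty_subset _)
    (fun _ _ h h' => Set.union_subset h h') hd
  let ψ₂ : f.Q ⊤ →ₗ[S] f.Q ⊤ :=
    { toFun := fun x => a • x
      map_add' := smul_add a
      map_smul' := by
        intro c x
        apply f.val_inj
        simp only [RingHom.id_apply, f.val_smul]
        rw [Set.inter_left_comm] }
  obtain ⟨χ₁, χ₂, _, h2, h3⟩ := diff_small hM A (f.sub_subtractive _ _ _ _) LinearMap.id ψ₂ (by
    intro x hx
    have hx : f.val x ⊆ f.toFun a := hx
    apply f.val_inj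
    change f.val x = f.val (a • x)
    rw [f.val_smul, Set.inter_eq_right.2 hx])
  obtain ⟨n, hn⟩ := f.qmk_surj ⊤ (χ₂ (f.qmk ⊤ 1))
  refine ⟨n, ?_⟩
  have e1 : f.toFun a ∩ f.toFun n = ∅ := by
    have hm : f.qmk ⊤ a ∈ A := by
      change f.val _ ⊆ _
      rw [f.val_mk]
    have := h2 _ hm
    have ha : f.qmk ⊤ a = a • f.qmk ⊤ 1 := by
      rw [← map_smul, smul_eq_mul, mul_one]
    rw [ha, map_smul, ← hn] at this
    have := congrArg f.val this
    rwa [f.val_smul, f.val_zero, f.val_mk] at this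
  have e2 : f.toFun a ∪ f.toFun n = Set.univ := by
    have := congrArg f.val (LinearMap.congr_fun h3 (f.qmk ⊤ 1))
    simp only [LinearMap.add_apply, LinearMap.id_apply, f.val_add, ← hn, f.val_mk, f.map_one,
      Set.univ_union] at this
    have h4 : f.val (ψ₂ (f.qmk ⊤ 1)) = f.toFun a := by
      change f.val (a • _) = _
      rw [f.val_smul, f.val_mk, f.map_one, Set.inter_univ]
    rw [h4] at this
    exact this.symm
  ext x
  have e1' := Set.ext_iff.1 e1 x
  have e2' := Set.ext_iff.1 e2 x
  simp only [Set.mem_inter_iff, Set.mem_union, Set.mem_univ, iff_true, Set.mem_empty_iff_false,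
    iff_false, Set.mem_compl_iff] at *
  tauto

end EInjAux

/-! ### Finite Boolean lattices -/

namespace EInjAux

/-- Over a finite Boolean lattice, every finitely generated semimodule is e-injective. -/
theorem eInjective_of_finite_boolean {S : Type u} [Semiring S]
    (comm : ∀ a b : S, a * b = b * a) (idem : ∀ a : S, a * a = a) (add1 : ∀ a : S, a + 1 = 1)
    (c : S → S) (hc0 : ∀ a, a * c a = 0) (hc1 : ∀ a, a + c a = 1)
    (hcm : ∀ a b, c (a * b) = c a + c b) (hca : ∀ a b, c (a + b) = c a * c b)
    (hcc : ∀ a, c (c a) = a)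
    (hfin : Finite S) {M : Type v} [AddCommMonoid M] [Module S M] (hM : Module.Finite S M) :
    EInjective.{u, v, w} S M := by
  classical
  have one1 : (1 : S) + 1 = 1 := add1 1
  -- a largest element of M
  have idemM : ∀ m : M, m + m = m := by
    intro m
    have := add_smul (1 : S) 1 m
    rw [one1, one_smul] at this
    exact this.symm
  have smulM : ∀ (s : S) (m : M), s • m + m = m := by
    intro s m
    have := add_smul s 1 m
    rw [add1, one_smul] at this
    exact this.symm
  obtain ⟨T, hT⟩ : ∃ T : M, ∀ m : M, m + T = T := by
    obtain ⟨G, hG⟩ := hM.fg_top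
    refine ⟨∑ g ∈ G, g, fun m => ?_⟩
    have hm : m ∈ Submodule.span S (G : Set M) := by rw [hG]; trivial
    induction hm using Submodule.span_induction with
    | mem x hx =>
      rw [← Finset.add_sum_erase G _ (Finset.mem_coe.1 hx), ← add_assoc, idemM]
    | zero => rw [zero_add]
    | add x y _ _ hx hy => rw [add_assoc, hy, hx]
    | smul a x _ hx =>
      calc a • x + ∑ g ∈ G, g = a • x + (x + ∑ g ∈ G, g) := by rw [hx]
        _ = _ := by rw [← add_assoc, smulM, hx]
  intro B _ _ A hA
  have smulB : ∀ (s : S) (m : B), s • m + m = m := by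
    intro s m
    have := add_smul s 1 m
    rw [add1, one_smul] at this
    exact this.symm
  have sub1 : ∀ x y : B, x + y ∈ A → x ∈ A := by
    intro x y h
    refine hA (x + y) x h ?_
    have : x + y + x = x + y := by
      have hx : x + x = x := by simpa using smulB 1 x
      rw [add_right_comm, hx]
    rwa [this]
  -- the largest scalar mapping b into A
  have hσ : ∀ b : B, ∃ s : S, s • b ∈ A ∧ ∀ t : S, t • b ∈ A → t * s = t := by
    intro b
    have := Fintype.ofFinite S
    refine ⟨∑ t ∈ Finset.univ.filter (fun t : S => t • b ∈ A), t, ?_, ?_⟩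
    · rw [Finset.sum_smul]
      exact A.sum_mem (fun t ht => (Finset.mem_filter.1 ht).2)
    · intro t ht
      rw [← Finset.add_sum_erase _ _ (Finset.mem_filter.2 ⟨Finset.mem_univ t, ht⟩)]
      rw [mul_add, idem]
      conv_lhs => enter [1]; rw [← mul_one t]
      rw [← mul_add, add_comm, add1, mul_one]
  choose σ hσA hσm using hσ
  have anti : ∀ s t : S, s * t = s → t * s = t → s = t := by
    intro s t h h'
    rw [← h, comm, h']
  have σeq : ∀ (b : B) (s : S), s • b ∈ A → (∀ t : S, t • b ∈ A → t * s = t) → σ b = s := by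
    intro b s h h'
    exact anti _ _ (h' _ (hσA b)) (hσm b s h)
  have σadd : ∀ x y : B, σ (x + y) = σ x * σ y := by
    intro x y
    apply σeq
    · rw [smul_add]
      refine A.add_mem ?_ ?_
      · rw [comm, mul_smul]
        exact A.smul_mem _ (hσA x)
      · rw [mul_smul]
        exact A.smul_mem _ (hσA y)
    · intro t ht
      rw [smul_add] at ht
      rw [← mul_assoc, hσm x t (sub1 _ _ ht), hσm y t (sub1 _ _ (by rwa [add_comm] at ht))]
  have cle : ∀ s t r : S, r * (t * s) = r * t → r * (s + c t) = r := by
    intro s t r h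
    calc r * (s + c t) = r * (t * s + c t) := by
          conv_lhs => rw [← one_mul s, ← hc1 t, add_mul]
          rw [add_assoc]
          congr 2
          conv_lhs => enter [2]; rw [← mul_one (c t)]
          rw [← mul_add, add1, mul_one]
      _ = r * (t + c t) := by rw [mul_add, h, ← mul_add]
      _ = r := by rw [hc1, mul_one]
  have σsmul : ∀ (t : S) (x : B), σ (t • x) = σ x + c t := by
    intro t x
    apply σeq
    · rw [add_smul]
      refine A.add_mem ?_ ?_
      · rw [← mul_smul, comm, mul_smul]
        exact A.smul_mem _ (hσA x)
      · rw [← mul_smul, comm, hc0, zero_smul]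
        exact A.zero_mem
    · intro r hr
      apply cle
      rw [← mul_smul] at hr
      rw [← mul_assoc]
      exact hσm x _ hr
  have σmem : ∀ x ∈ A, σ x = 1 := by
    intro x hx
    apply σeq
    · rwa [one_smul]
    · intro t _
      rw [mul_one]
  have c1 : c 1 = 0 := by rw [← one_mul (c 1), hc0]
  -- the map vanishing on A and as large as possible outside A
  let χ : B →ₗ[S] M :=
    { toFun := fun x => c (σ x) • T
      map_add' := by
        intro x y
        rw [σadd, hcm, add_smul]
      map_smul' := by
        intro t x
        rw [σsmul, hca, hcc, RingHom.id_apply, ← mul_smul, comm] }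
  have hχ : ∀ x, χ x = c (σ x) • T := fun _ => rfl
  have χ0 : ∀ a ∈ A, χ a = 0 := by
    intro a ha
    rw [hχ, σmem a ha, c1, zero_smul]
  -- absorption
  have absorb : ∀ (s : S) (m : M), s • m + s • T = s • T := by
    intro s m
    rw [← smul_add, hT]
  have split : ∀ (s : S) (m : M), m + c s • T = s • m + c s • T := by
    intro s m
    calc m + c s • T = (s + c s) • m + c s • T := by rw [hc1, one_smul]
      _ = _ := by rw [add_smul, add_assoc, absorb]
  constructor
  · intro φ
    let p : B → A := fun x => ⟨σ x • x, hσA x⟩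
    have key : ∀ (x : B) (s : S), φ (p x) + c (s * σ x) • T
        = φ (s • p x) + c (s * σ x) • T := by
      intro x s
      rw [split (s * σ x) (φ (p x)), ← map_smul]
      congr 2
      apply Subtype.ext
      change (s * σ x) • σ x • x = s • σ x • x
      rw [← mul_smul, mul_assoc, idem, mul_smul]
    refine ⟨{ toFun := fun x => φ (p x) + χ x, map_add' := ?_, map_smul' := ?_ }, ?_⟩
    · intro x y
      have e1 : p (x + y) = σ y • p x + σ x • p y := by
        apply Subtype.ext
        change σ (x + y) • (x + y) = σ y • σ x • x + σ x • σ y • y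
        rw [σadd, smul_add, ← mul_smul, ← mul_smul, comm (σ y)]
      have k1 := key x (σ y)
      have k2 := key y (σ x)
      rw [comm (σ y)] at k1
      have hxy : χ x + χ y = c (σ x * σ y) • T := by
        rw [← map_add, hχ, σadd]
      rw [map_add χ, e1, map_add φ, hxy, add_add_add_comm (φ (p x)), hxy]
      rw [add_assoc, ← k2, add_left_comm, ← k1, add_left_comm, ← add_assoc]
    · intro t x
      rw [map_smul, RingHom.id_apply, smul_add, ← map_smul φ]
      congr 2
      apply Subtype.ext
      change σ (t • x) • t • x = t • σ x • x
      rw [σsmul, ← mul_smul, add_mul, comm (c t), hc0, add_zero, comm, mul_smul]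
    · intro a
      change φ (p a) + χ a = φ a
      rw [χ0 _ a.2, add_zero]
      congr 1
      apply Subtype.ext
      change σ (a : B) • (a : B) = a
      rw [σmem _ a.2, one_smul]
  · intro ψ₁ ψ₂ h
    refine ⟨χ, χ, χ0, χ0, ?_⟩
    ext x
    rw [LinearMap.add_apply, LinearMap.add_apply, hχ, split (σ x) (ψ₁ x), split (σ x) (ψ₂ x),
      ← map_smul, ← map_smul, h _ (hσA x)]

end EInjAux

/-! ### The infinite case -/

namespace EInjAux

/-- The almost disjoint family of branches, coded in the natural numbers. -/
def branch (g : Set ℕ) : Set ℕ :=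
  {k | ∃ n : ℕ, ∃ F : Finset ℕ, (∀ m, m ∈ F ↔ m < n ∧ m ∈ g) ∧ k = Encodable.encode (n, F)}

theorem branch_exists (g : Set ℕ) (n : ℕ) : ∃ F : Finset ℕ, ∀ m, m ∈ F ↔ m < n ∧ m ∈ g := by
  classical
  exact ⟨(Finset.range n).filter (fun m => m ∈ g), fun m => by simp⟩

theorem branch_infinite (g : Set ℕ) : (branch g).Infinite := by
  choose F hF using branch_exists g
  refine Set.infinite_of_injective_forall_mem (f := fun n => Encodable.encode (n, F n)) ?_ ?_
  · intro a b h
    have := Encodable.encode_injective h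
    exact (Prod.mk.inj this).1
  · intro n
    exact ⟨n, F n, hF n, rfl⟩

theorem branch_inter {g h : Set ℕ} (hne : g ≠ h) : (branch g ∩ branch h).Finite := by
  obtain ⟨m, hm⟩ : ∃ m, ¬ (m ∈ g ↔ m ∈ h) := by
    by_contra hcon
    push Not at hcon
    exact hne (Set.ext hcon)
  choose F hF using branch_exists g
  refine ((Set.finite_Iic m).image (fun n => Encodable.encode (n, F n))).subset ?_
  rintro k ⟨⟨n, G, hG, rfl⟩, ⟨n', G', hG', he⟩⟩
  obtain ⟨rfl, rfl⟩ := Prod.mk.inj (Encodable.encode_injective he)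
  refine ⟨n, ?_, ?_⟩
  · by_contra hlt
    have hlt : m < n := not_le.1 hlt
    have h1 := hG m
    have h2 := hG' m
    tauto
  · have : F n = G := by
      ext j
      rw [hF, hG]
    simp only [this]

/-- The set-ideal generated by finite sets and by the branches in `K`. -/
def brIdeal (K : Set (Set ℕ)) (U : Set ℕ) : Prop :=
  ∃ F : Finset (Set ℕ), (∀ g ∈ F, g ∈ K) ∧ (U \ {k | ∃ g ∈ F, k ∈ branch g}).Finite

theorem brIdeal_empty (K : Set (Set ℕ)) : brIdeal K ∅ := ⟨∅, by simp, by simp⟩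

theorem brIdeal_mono (K : Set (Set ℕ)) {U V : Set ℕ} (h : U ⊆ V) (hV : brIdeal K V) :
    brIdeal K U := by
  obtain ⟨F, hF, hfin⟩ := hV
  exact ⟨F, hF, hfin.subset (fun x hx => ⟨h hx.1, hx.2⟩)⟩

theorem brIdeal_union (K : Set (Set ℕ)) {U V : Set ℕ} (hU : brIdeal K U) (hV : brIdeal K V) :
    brIdeal K (U ∪ V) := by
  classical
  obtain ⟨F, hF, hfin⟩ := hU
  obtain ⟨F', hF', hfin'⟩ := hV
  refine ⟨F ∪ F', ?_, (hfin.union hfin').subset ?_⟩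
  · intro g hg
    rcases Finset.mem_union.1 hg with h | h
    · exact hF g h
    · exact hF' g h
  · rintro x ⟨hx, hn⟩
    have hn1 : ∀ g ∈ F, x ∉ branch g :=
      fun g hg hx' => hn ⟨g, Finset.mem_union_left _ hg, hx'⟩
    have hn2 : ∀ g ∈ F', x ∉ branch g :=
      fun g hg hx' => hn ⟨g, Finset.mem_union_right _ hg, hx'⟩
    rcases hx with hx | hx
    · exact Or.inl ⟨hx, fun ⟨g, hg, hx'⟩ => hn1 g hg hx'⟩
    · exact Or.inr ⟨hx, fun ⟨g, hg, hx'⟩ => hn2 g hg hx'⟩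

theorem brIdeal_branch {K : Set (Set ℕ)} {g : Set ℕ} (hg : g ∈ K) : brIdeal K (branch g) := by
  refine ⟨{g}, by simpa using hg, ?_⟩
  convert Set.finite_empty
  ext x
  simp

theorem brIdeal_orth (K : Set (Set ℕ)) {U : Set ℕ} (h : brIdeal K U) (h' : brIdeal Kᶜ U) :
    U.Finite := by
  obtain ⟨F, hF, hfin⟩ := h
  obtain ⟨F', hF', hfin'⟩ := h'
  have hbig : (⋃ g ∈ F, ⋃ g' ∈ F', branch g ∩ branch g').Finite := by
    refine Set.Finite.biUnion F.finite_toSet (fun g hg => ?_)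
    refine Set.Finite.biUnion F'.finite_toSet (fun g' hg' => ?_)
    apply branch_inter
    rintro rfl
    exact hF' g hg' (hF g hg)
  refine ((hfin.union hfin').union hbig).subset ?_
  intro x hx
  by_cases h1 : ∃ g ∈ F, x ∈ branch g
  · by_cases h2 : ∃ g ∈ F', x ∈ branch g
    · obtain ⟨g, hg, hxg⟩ := h1
      obtain ⟨g', hg', hxg'⟩ := h2
      refine Or.inr ?_
      simp only [Set.mem_iUnion]
      exact ⟨g, hg, g', hg', hxg, hxg'⟩
    · exact Or.inl (Or.inr ⟨hx, h2⟩)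
  · exact Or.inl (Or.inl ⟨hx, h1⟩)

/-- No representation on `ℕ` containing all singletons has all its quotients e-injective. -/
theorem no_rep {S : Type u} [Semiring S] (f : Rep S ℕ)
    (hf : ∀ n, ∃ s, f.toFun s = {n})
    (h1 : EInjective.{u, u, w} S (f.Q ⊤))
    (h2 : EInjective.{u, u, w} S (f.Q Filter.cofinite)) : False := by
  -- all finite sets are represented
  have hfin : ∀ U : Set ℕ, U.Finite → ∃ s, f.toFun s = U := by
    intro U hU
    induction U, hU using Set.Finite.induction_on with
    | empty => exact ⟨0, f.map_zero⟩
    | @insert a U _ _ ih =>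
      obtain ⟨s, hs⟩ := ih
      obtain ⟨t, ht⟩ := hf a
      exact ⟨t + s, by rw [f.map_add, hs, ht, Set.insert_eq]⟩
  -- hence all sets
  have hsurj : ∀ K : Set ℕ, ∃ s, f.toFun s = K := by
    intro K
    obtain ⟨s, hs⟩ := f.extend ⊤ h1 Set.Finite Set.finite_empty (fun _ _ h h' => h.union h')
      (fun _ _ h h' => h'.subset h) (fun U V => V = U ∩ K)
      (fun U hU => hfin _ (hU.inter_of_left K))
      (fun U V V' h h' => setEq_top.2 (by rw [h, h']))
      (fun U V U' V' h h' => by rw [h, h', Set.union_inter_distrib_right])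
      (fun s U V h => by rw [h, Set.inter_assoc])
    refine ⟨s, ?_⟩
    ext n
    obtain ⟨t, ht⟩ := hf n
    have := hs t _ (by rw [ht]; exact Set.finite_singleton n) rfl
    rw [setEq_top, ht] at this
    have := Set.ext_iff.1 this n
    simpa using this
  -- separation of orthogonal ideals
  have hsep : ∀ K : Set (Set ℕ), ∃ Y : Set ℕ,
      ∀ g, ((branch g) \ Y).Finite ↔ g ∈ K := by
    intro K
    obtain ⟨s, hs⟩ := f.extend Filter.cofinite h2
      (fun U => ∃ i j, brIdeal K i ∧ brIdeal Kᶜ j ∧ U = i ∪ j)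
      ⟨∅, ∅, brIdeal_empty _, brIdeal_empty _, by simp⟩
      (by
        rintro _ _ ⟨i, j, hi, hj, rfl⟩ ⟨i', j', hi', hj', rfl⟩
        exact ⟨i ∪ i', j ∪ j', brIdeal_union _ hi hi', brIdeal_union _ hj hj',
          Set.union_union_union_comm _ _ _ _⟩)
      (by
        rintro U _ hUV ⟨i, j, hi, hj, rfl⟩
        refine ⟨U ∩ i, U ∩ j, brIdeal_mono _ Set.inter_subset_right hi,
          brIdeal_mono _ Set.inter_subset_right hj, ?_⟩
        rw [← Set.inter_union_distrib_left, Set.inter_eq_left.2 hUV])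
      (fun U V => ∃ j, brIdeal K V ∧ brIdeal Kᶜ j ∧ U = V ∪ j)
      (by
        rintro _ ⟨i, j, hi, hj, rfl⟩
        obtain ⟨s, hs⟩ := hsurj i
        exact ⟨s, j, hs ▸ hi, hj, by rw [hs]⟩)
      (by
        rintro U V V' ⟨j, hV, hj, hU⟩ ⟨j', hV', hj', hU'⟩
        have a1 : (V \ V').Finite := by
          apply brIdeal_orth K (brIdeal_mono K Set.sdiff_subset hV)
          refine brIdeal_mono _ ?_ hj'
          rintro x ⟨hx, hx'⟩
          have : x ∈ V' ∪ j' := by rw [← hU', hU]; exact Or.inl hx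
          exact this.resolve_left hx'
        have a2 : (V' \ V).Finite := by
          apply brIdeal_orth K (brIdeal_mono K Set.sdiff_subset hV')
          refine brIdeal_mono _ ?_ hj
          rintro x ⟨hx, hx'⟩
          have : x ∈ V ∪ j := by rw [← hU, hU']; exact Or.inl hx
          exact this.resolve_left hx'
        rw [Filter.eventuallyEq_set, Filter.eventually_cofinite]
        refine (a1.union a2).subset ?_
        intro x hx
        have hx : ¬ (x ∈ V ↔ x ∈ V') := hx
        change (x ∈ V ∧ x ∉ V') ∨ (x ∈ V' ∧ x ∉ V)
        tauto)
      (by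
        rintro _ V _ V' ⟨j, hV, hj, rfl⟩ ⟨j', hV', hj', rfl⟩
        exact ⟨j ∪ j', brIdeal_union _ hV hV', brIdeal_union _ hj hj',
          Set.union_union_union_comm _ _ _ _⟩)
      (by
        rintro s _ V ⟨j, hV, hj, rfl⟩
        exact ⟨f.toFun s ∩ j, brIdeal_mono _ Set.inter_subset_right hV,
          brIdeal_mono _ Set.inter_subset_right hj, Set.inter_union_distrib_left _ _ _⟩)
    refine ⟨f.toFun s, fun g => ?_⟩
    obtain ⟨t, ht⟩ := hsurj (branch g)
    by_cases hg : g ∈ K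
    · have := hs t (branch g)
        (by rw [ht]; exact ⟨branch g, ∅, brIdeal_branch hg, brIdeal_empty _, by simp⟩)
        (by rw [ht]; exact ⟨∅, brIdeal_branch hg, brIdeal_empty _, by simp⟩)
      rw [Filter.eventuallyEq_set, Filter.eventually_cofinite, ht] at this
      simp only [hg, iff_true]
      refine this.subset ?_
      rintro x ⟨hx, hx'⟩ hiff
      exact hx' (hiff.2 hx).2
    · have := hs t ∅
        (by rw [ht]; exact ⟨∅, branch g, brIdeal_empty _, brIdeal_branch hg, by simp⟩)
        (by rw [ht]; exact ⟨branch g, brIdeal_empty _, brIdeal_branch hg, by simp⟩)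
      rw [Filter.eventuallyEq_set, Filter.eventually_cofinite, ht] at this
      simp only [hg, iff_false]
      intro hfin
      refine branch_infinite g ((hfin.union this).subset ?_)
      intro x hx
      by_cases hxs : x ∈ f.toFun s
      · exact Or.inr (fun hiff => (hiff.1 ⟨hx, hxs⟩).elim)
      · exact Or.inl ⟨hx, hxs⟩
  refine Function.cantor_surjective (fun Y : Set ℕ => {g : Set ℕ | ((branch g) \ Y).Finite}) ?_
  intro K
  obtain ⟨Y, hY⟩ := hsep K
  exact ⟨Y, Set.ext hY⟩

end EInjAux

namespace EInjAux

/-- The representation of a lattice semiring given by a family of prime ideals. -/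
def repOfPrimes {S : Type u} [DistribLattice S] [BoundedOrder S] [Semiring S]
    (hadd : ∀ a b : S, a + b = a ⊔ b) (hmul : ∀ a b : S, a * b = a ⊓ b)
    (hzero : (0 : S) = ⊥) (hone : (1 : S) = ⊤) {X : Type} (P : X → Order.Ideal S)
    (hP : ∀ x, (P x).IsPrime) : Rep S X where
  toFun s := {x | s ∉ P x}
  map_add s t := by
    ext x
    change s + t ∉ P x ↔ (s ∉ P x ∨ t ∉ P x)
    rw [hadd, Order.Ideal.sup_mem_iff]
    tauto
  map_mul s t := by
    ext x
    change s * t ∉ P x ↔ (s ∉ P x ∧ t ∉ P x)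
    rw [hmul]
    have h1 : s ⊓ t ∈ P x → s ∈ P x ∨ t ∈ P x := (hP x).mem_or_mem
    have h2 : s ∈ P x → s ⊓ t ∈ P x := (P x).lower inf_le_left
    have h3 : t ∈ P x → s ⊓ t ∈ P x := (P x).lower inf_le_right
    tauto
  map_one := by
    ext x
    change 1 ∉ P x ↔ True
    rw [hone]
    simpa using (hP x).1.top_notMem
  map_zero := by
    ext x
    change 0 ∉ P x ↔ False
    rw [hzero]
    simp

theorem exists_primes {S : Type u} [DistribLattice S] [BoundedOrder S] (a : S)
    (ha : ¬ ∃ b, IsCompl a b) :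
    ∃ p q : Order.Ideal S, p.IsPrime ∧ q.IsPrime ∧ p ≤ q ∧ a ∈ q ∧ a ∉ p := by
  have hI : Order.IsIdeal {x : S | ∃ y, y ⊓ a = ⊥ ∧ x ≤ y ⊔ a} := by
    refine ⟨?_, ?_, ?_⟩
    · rintro x z hzx ⟨y, hy, hx⟩
      exact ⟨y, hy, hzx.trans hx⟩
    · exact ⟨⊥, ⊥, bot_inf_eq _, bot_le⟩
    · rintro x ⟨y, hy, hx⟩ x' ⟨y', hy', hx'⟩
      refine ⟨x ⊔ x', ⟨y ⊔ y', ?_, ?_⟩, le_sup_left, le_sup_right⟩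
      · rw [inf_sup_right, hy, hy', sup_bot_eq]
      · exact sup_le (hx.trans (sup_le_sup_right le_sup_left _))
          (hx'.trans (sup_le_sup_right le_sup_right _))
  have hdis : Disjoint ((Order.PFilter.principal (⊤ : S) : Order.PFilter S) : Set S)
      (hI.toIdeal : Set S) := by
    rw [Set.disjoint_left]
    rintro x hx ⟨y, hy, hx'⟩
    have hx : ⊤ ≤ x := hx
    refine ha ⟨y, ?_, ?_⟩
    · rw [disjoint_iff, inf_comm, hy]
    · rw [codisjoint_iff, sup_comm]
      exact top_le_iff.1 (hx.trans hx')
  obtain ⟨q, hq, hIq, -⟩ := DistribLattice.prime_ideal_of_disjoint_filter_ideal hdis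
  have hIq' : ∀ x y, y ⊓ a = ⊥ → x ≤ y ⊔ a → x ∈ q := fun x y h h' => hIq ⟨y, h, h'⟩
  have haq : a ∈ q := hIq' a ⊥ (bot_inf_eq _) le_sup_right
  have hF : Order.IsPFilter {x : S | ∃ s, s ∉ q ∧ s ⊓ a ≤ x} := by
    refine Order.IsPFilter.of_def ?_ ?_ ?_
    · exact ⟨⊤, ⊤, hq.1.top_notMem, le_top⟩
    · rintro x ⟨s, hs, hx⟩ x' ⟨s', hs', hx'⟩
      refine ⟨x ⊓ x', ⟨s ⊓ s', ?_, ?_⟩, inf_le_left, inf_le_right⟩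
      · intro h
        rcases hq.mem_or_mem h with h | h
        · exact hs h
        · exact hs' h
      · exact le_inf ((inf_le_inf_right _ inf_le_left).trans hx)
          ((inf_le_inf_right _ inf_le_right).trans hx')
    · rintro x y hxy ⟨s, hs, hx⟩
      exact ⟨s, hs, hx.trans hxy⟩
  have hdis2 : Disjoint ((hF.toPFilter : Order.PFilter S) : Set S)
      ((⊥ : Order.Ideal S) : Set S) := by
    rw [Set.disjoint_left]
    rintro x ⟨s, hs, hx⟩ hx0
    have hx0 : x ∈ (⊥ : Order.Ideal S) := hx0
    have hx0 : x ≤ ⊥ := by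
      have h : (⊥ : Order.Ideal S) ≤ Order.Ideal.principal ⊥ := bot_le
      exact h hx0
    exact hs (hIq' s s (le_bot_iff.1 (hx.trans hx0)) le_sup_left)
  obtain ⟨p, hp, -, hFp⟩ := DistribLattice.prime_ideal_of_disjoint_filter_ideal hdis2
  rw [Set.disjoint_left] at hFp
  refine ⟨p, q, hp, hq, ?_, haq, ?_⟩
  · intro x hx
    by_contra hxq
    exact hFp (show x ∈ hF.toPFilter from ⟨x, hxq, inf_le_left⟩) hx
  · intro h
    exact hFp (show a ∈ hF.toPFilter from ⟨⊤, hq.1.top_notMem, inf_le_right⟩) h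

/-- An infinite Boolean algebra has an infinite sequence of disjoint nonzero elements. -/
theorem exists_disjoint_seq {S : Type u} [BooleanAlgebra S] (hS : Infinite S) :
    ∃ x : ℕ → S, (∀ n, x n ≠ ⊥) ∧ ∀ m n, m ≠ n → x m ⊓ x n = ⊥ := by
  have step : ∀ a : {a : S // (Set.Iic a).Infinite}, ∃ b : {a : S // (Set.Iic a).Infinite},
      b.1 ≤ a.1 ∧ ∃ x, x ≤ a.1 ∧ x ≠ ⊥ ∧ x ⊓ b.1 = ⊥ := by
    classical
    rintro ⟨a, ha⟩
    obtain ⟨b, hb, hb'⟩ := ha.exists_notMem_finset {⊥, a}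
    have hba : b ≤ a := hb
    have hb0 : b ≠ ⊥ := by
      rintro rfl
      simp at hb'
    have hbne : b ≠ a := by
      rintro rfl
      simp at hb'
    have hc0 : a ⊓ bᶜ ≠ ⊥ := by
      intro h
      have : a ≤ b := by
        rw [← sdiff_eq, sdiff_eq_bot_iff] at h
        exact h
      exact hbne (le_antisymm hba this)
    have hor : (Set.Iic b).Infinite ∨ (Set.Iic (a ⊓ bᶜ)).Infinite := by
      by_contra hcon
      rw [not_or, Set.not_infinite, Set.not_infinite] at hcon
      refine ha ((hcon.1.image2 (fun x y => x ⊔ y) hcon.2).subset ?_)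
      intro y hy
      have hy : y ≤ a := hy
      refine ⟨y ⊓ b, inf_le_right, y ⊓ bᶜ, inf_le_inf_right _ hy, ?_⟩
      change y ⊓ b ⊔ y ⊓ bᶜ = y
      rw [← inf_sup_left, sup_compl_eq_top, inf_top_eq]
    rcases hor with h | h
    · refine ⟨⟨b, h⟩, hba, a ⊓ bᶜ, inf_le_left, hc0, ?_⟩
      change a ⊓ bᶜ ⊓ b = ⊥
      rw [inf_assoc, compl_inf_eq_bot, inf_bot_eq]
    · refine ⟨⟨a ⊓ bᶜ, h⟩, inf_le_left, b, hba, hb0, ?_⟩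
      change b ⊓ (a ⊓ bᶜ) = ⊥
      rw [inf_left_comm, inf_compl_eq_bot, inf_bot_eq]
  choose nx hnx x hx hx0 hxd using step
  have htop : (Set.Iic (⊤ : S)).Infinite := by
    rw [Set.Iic_top]
    exact Set.infinite_univ
  let a : ℕ → {a : S // (Set.Iic a).Infinite} := fun n => nx^[n] ⟨⊤, htop⟩
  have hsucc : ∀ n, a (n + 1) = nx (a n) := fun n => Function.iterate_succ_apply' _ _ _
  have hanti : Antitone (fun n => (a n).1) := by
    refine antitone_nat_of_succ_le (fun n => ?_)
    rw [hsucc]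
    exact hnx _
  have hlt : ∀ m n, m < n → x (a m) ⊓ x (a n) = ⊥ := by
    intro m n hmn
    have h1 : x (a n) ≤ (a (m + 1)).1 := (hx _).trans (hanti hmn)
    rw [hsucc] at h1
    rw [← le_bot_iff, ← hxd (a m)]
    exact inf_le_inf_left _ h1
  refine ⟨fun n => x (a n), fun n => hx0 _, fun m n hmn => ?_⟩
  rcases lt_or_gt_of_ne hmn with h | h
  · exact hlt m n h
  · rw [inf_comm]
    exact hlt n m h

theorem exists_prime_notMem {S : Type u} [DistribLattice S] [BoundedOrder S] (a : S)
    (ha : a ≠ ⊥) : ∃ p : Order.Ideal S, p.IsPrime ∧ a ∉ p := by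
  have hdis : Disjoint ((Order.PFilter.principal a : Order.PFilter S) : Set S)
      ((Order.Ideal.principal (⊥ : S) : Order.Ideal S) : Set S) := by
    rw [Set.disjoint_left]
    intro x hx hx'
    have hx : a ≤ x := hx
    have hx' : x ≤ ⊥ := hx'
    exact ha (le_bot_iff.1 (hx.trans hx'))
  obtain ⟨p, hp, -, h⟩ := DistribLattice.prime_ideal_of_disjoint_filter_ideal hdis
  rw [Set.disjoint_left] at h
  exact ⟨p, hp, h (show a ≤ a from le_rfl)⟩

theorem complemented_of_cyclic {S : Type u} [DistribLattice S] [BoundedOrder S] [Semiring S]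
    (hadd : ∀ a b : S, a + b = a ⊔ b) (hmul : ∀ a b : S, a * b = a ⊓ b)
    (hzero : (0 : S) = ⊥) (hone : (1 : S) = ⊤)
    (h : ∀ (M : Type u) [AddCommMonoid M] [Module S M],
        (∃ m : M, Submodule.span S {m} = ⊤) → EInjective.{u, u, w} S M) :
    ComplementedLattice S := by
  refine ⟨fun a => ?_⟩
  by_contra ha
  obtain ⟨p, q, hp, hq, hpq, haq, hap⟩ := exists_primes a ha
  let f := repOfPrimes hadd hmul hzero hone (X := Bool) (fun b => if b then p else q)
    (by
      intro b
      cases b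
      · exact hq
      · exact hp)
  obtain ⟨n, hn⟩ := f.compl (h (f.Q ⊤) (f.cyclic ⊤)) a
  have h1 := Set.ext_iff.1 hn true
  have h2 := Set.ext_iff.1 hn false
  have h1 : n ∉ p ↔ ¬ a ∉ p := h1
  have h2 : n ∉ q ↔ ¬ a ∉ q := h2
  have h3 : n ∈ p → n ∈ q := fun h => hpq h
  tauto

theorem finite_of_cyclic {S : Type u} [DistribLattice S] [BoundedOrder S] [Semiring S]
    (hadd : ∀ a b : S, a + b = a ⊔ b) (hmul : ∀ a b : S, a * b = a ⊓ b)
    (hzero : (0 : S) = ⊥) (hone : (1 : S) = ⊤) [ComplementedLattice S]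
    (h : ∀ (M : Type u) [AddCommMonoid M] [Module S M],
        (∃ m : M, Submodule.span S {m} = ⊤) → EInjective.{u, u, w} S M) :
    Finite S := by
  by_contra hS
  rw [not_finite_iff_infinite] at hS
  obtain ⟨x, hx0, hxd⟩ : ∃ x : ℕ → S, (∀ n, x n ≠ ⊥) ∧ ∀ m n, m ≠ n → x m ⊓ x n = ⊥ :=
    @exists_disjoint_seq S (DistribLattice.booleanAlgebraOfComplemented S) hS
  choose P hP hxP using fun n => exists_prime_notMem (x n) (hx0 n)
  let f := repOfPrimes hadd hmul hzero hone P hP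
  refine no_rep f (fun n => ⟨x n, ?_⟩) (h _ (f.cyclic ⊤)) (h _ (f.cyclic _))
  ext m
  change x n ∉ P m ↔ m = n
  constructor
  · intro hm
    by_contra hne
    have h1 : x m ⊓ x n ∈ P m := by
      rw [hxd m n hne]
      exact Order.Ideal.bot_mem _
    rcases (hP m).mem_or_mem h1 with h | h
    · exact hxP m h
    · exact hm h
  · rintro rfl
    exact hxP m

theorem eInjective_of_finite {S : Type u} [DistribLattice S] [BoundedOrder S] [Semiring S]
    (hadd : ∀ a b : S, a + b = a ⊔ b) (hmul : ∀ a b : S, a * b = a ⊓ b)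
    (hzero : (0 : S) = ⊥) (hone : (1 : S) = ⊤) (h : Finite S ∧ ComplementedLattice S)
    (M : Type u) [AddCommMonoid M] [Module S M] (hM : Module.Finite S M) :
    EInjective.{u, u, w} S M := by
  obtain ⟨hfin, hcompl⟩ := h
  obtain ⟨c, h1, h2, h3, h4, h5⟩ : ∃ c : S → S, (∀ a, a ⊓ c a = ⊥) ∧ (∀ a, a ⊔ c a = ⊤) ∧
      (∀ a b, c (a ⊓ b) = c a ⊔ c b) ∧ (∀ a b, c (a ⊔ b) = c a ⊓ c b) ∧ (∀ a, c (c a) = a) := by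
    letI := DistribLattice.booleanAlgebraOfComplemented S
    exact ⟨compl, fun _ => inf_compl_eq_bot, fun _ => sup_compl_eq_top,
      fun _ _ => compl_inf, fun _ _ => compl_sup, fun _ => compl_compl _⟩
  refine eInjective_of_finite_boolean (fun a b => ?_) (fun a => ?_) (fun a => ?_) c
    (fun a => ?_) (fun a => ?_) (fun a b => ?_) (fun a b => ?_) h5 hfin hM
  · rw [hmul, hmul, inf_comm]
  · rw [hmul, inf_idem]
  · rw [hadd, hone, sup_top_eq]
  · rw [hmul, hzero, h1]
  · rw [hadd, hone, h2]
  · rw [hmul, hadd, h3]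
  · rw [hmul, hadd, h4]

theorem finite_boolean_of_cyclic {S : Type u} [DistribLattice S] [BoundedOrder S] [Semiring S]
    (hadd : ∀ a b : S, a + b = a ⊔ b) (hmul : ∀ a b : S, a * b = a ⊓ b)
    (hzero : (0 : S) = ⊥) (hone : (1 : S) = ⊤)
    (h : ∀ (M : Type u) [AddCommMonoid M] [Module S M],
        (∃ m : M, Submodule.span S {m} = ⊤) → EInjective.{u, u, w} S M) :
    Finite S ∧ ComplementedLattice S := by
  have hc := complemented_of_cyclic hadd hmul hzero hone h
  exact ⟨finite_of_cyclic hadd hmul hzero hone h, hc⟩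

theorem finite_of_span {S : Type u} [Semiring S] {M : Type u} [AddCommMonoid M] [Module S M]
    (h : ∃ m : M, Submodule.span S {m} = ⊤) : Module.Finite S M := by
  obtain ⟨m, hm⟩ := h
  exact ⟨⟨{m}, by simpa using hm⟩⟩

end EInjAux

/-- Theorem 6.5: for a bounded distributive lattice `S`, regarded as a commutative
semiring with `+ = ⊔`, `* = ⊓`, `0 = ⊥`, `1 = ⊤`, the following are equivalent:
all finitely generated `S`-semimodules are e-injective; all cyclic `S`-semimodules are
e-injective; `S` is a finite Boolean algebra. -/
theorem boundedDistribLattice_eInjective_iff {S : Type u} [DistribLattice S] [BoundedOrder S]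
    [Semiring S]
    (hadd : ∀ a b : S, a + b = a ⊔ b) (hmul : ∀ a b : S, a * b = a ⊓ b)
    (hzero : (0 : S) = ⊥) (hone : (1 : S) = ⊤) :
    ((∀ (M : Type u) [AddCommMonoid M] [Module S M], Module.Finite S M → EInjective S M) ↔
      (∀ (M : Type u) [AddCommMonoid M] [Module S M],
        (∃ m : M, Submodule.span S {m} = ⊤) → EInjective S M)) ∧
    ((∀ (M : Type u) [AddCommMonoid M] [Module S M],
        (∃ m : M, Submodule.span S {m} = ⊤) → EInjective S M) ↔
      (Finite S ∧ ComplementedLattice S)) := by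
  refine ⟨⟨fun h => ?_, fun h => ?_⟩, fun h => ?_, fun h => ?_⟩
  · intro M _ _ hM
    exact EInjAux.eInjective_of_finite hadd hmul hzero hone
      (EInjAux.finite_boolean_of_cyclic hadd hmul hzero hone
        (fun N _ _ hN => h N (EInjAux.finite_of_span hN))) M (EInjAux.finite_of_span hM)
  · intro M _ _ hM
    exact EInjAux.eInjective_of_finite hadd hmul hzero hone
      (EInjAux.finite_boolean_of_cyclic hadd hmul hzero hone h) M hM
  · exact EInjAux.finite_boolean_of_cyclic hadd hmul hzero hone h
  · intro M _ _ hM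
    exact EInjAux.eInjective_of_finite hadd hmul hzero hone h M (EInjAux.finite_of_span hM)
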